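/- Let p be a prime with p ≡ 3 (mod 4), and let a, b ∈ ℚ be nonzero rationals such that: ℍ[ℝ, a, b] is a division algebra, ℍ[ℚₚ, a, b] is a division algebra, and for every prime ℓ ≠ p there is an isomorphism of ℚ_ℓ-algebras ℍ[ℚ_ℓ, a, b] ≅ M₂(ℚ_ℓ). Then there is an isomorphism of ℚ-algebras ℍ[ℚ, a, b] ≅ ℍ[ℚ, −1, −p]. -/

import Mathlib

open Quaternion

namespace QRam

/-- Quaternion algebras: two anticommuting elements with prescribed squares give an isomorphism. -/
theorem iso_of_elements {a b c d : ℚ} (hc : c < 0) (hd : d < 0) (u v : ℍ[ℚ, a, b])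
    (hu : u * u = c • 1) (hv : v * v = d • 1) (huv : v * u = - (u * v)) :
    Nonempty (ℍ[ℚ, c, d] ≃ₐ[ℚ] ℍ[ℚ, a, b]) := by
  let q : QuaternionAlgebra.Basis ℍ[ℚ, a, b] c 0 d :=
    { i := u, j := v, k := u * v, i_mul_i := by simpa using hu, j_mul_j := hv, i_mul_j := rfl
      j_mul_i := by simpa using huv }
  have hinj : Function.Injective q.liftHom := by
    rw [injective_iff_map_eq_zero]
    intro x hx
    have h1 : q.liftHom (x * star x) = 0 := by rw [map_mul, hx, zero_mul]
    have h2 : x * star x = algebraMap ℚ ℍ[ℚ, c, d]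
        (x.re ^ 2 - c * x.imI ^ 2 - d * x.imJ ^ 2 + c * d * x.imK ^ 2) := by
      ext <;> simp [QuaternionAlgebra.algebraMap_eq] <;> ring
    rw [h2, AlgHom.commutes, map_eq_zero_iff _ (algebraMap ℚ ℍ[ℚ, a, b]).injective] at h1
    have e1 : 0 ≤ x.re ^ 2 := sq_nonneg _
    have e2 : 0 ≤ -c * x.imI ^ 2 := mul_nonneg (by linarith) (sq_nonneg _)
    have e3 : 0 ≤ -d * x.imJ ^ 2 := mul_nonneg (by linarith) (sq_nonneg _)
    have e4 : 0 ≤ c * d * x.imK ^ 2 := mul_nonneg (by nlinarith) (sq_nonneg _)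
    have f1 : x.re ^ 2 = 0 := by linarith
    have f2 : -c * x.imI ^ 2 = 0 := by linarith
    have f3 : -d * x.imJ ^ 2 = 0 := by linarith
    have f4 : c * d * x.imK ^ 2 = 0 := by linarith
    ext <;> simp_all [hc.ne, hd.ne]
  have hfr : Module.finrank ℚ ℍ[ℚ, c, d] = Module.finrank ℚ ℍ[ℚ, a, b] := by
    rw [QuaternionAlgebra.finrank_eq_four, QuaternionAlgebra.finrank_eq_four]
  have hbij : Function.Bijective q.liftHom :=
    ⟨hinj, (LinearMap.injective_iff_surjective_of_finrank_eq_finrank (f := q.liftHom.toLinearMap) hfr).1 hinj⟩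
  exact ⟨AlgEquiv.ofBijective q.liftHom hbij⟩

theorem iso_neg_mul {a b : ℚ} (ha : a < 0) (hb : b < 0) :
    Nonempty (ℍ[ℚ, a, -(a * b)] ≃ₐ[ℚ] ℍ[ℚ, a, b]) := by
  refine iso_of_elements ha (by nlinarith) ⟨0, 1, 0, 0⟩ ⟨0, 0, 0, 1⟩ ?_ ?_ ?_ <;>
    ext <;> simp

theorem iso_step1 {a b x y Q : ℚ} (ha : a < 0) (hb : b < 0) (hQ : 0 < Q)
    (h : a * x ^ 2 + b * y ^ 2 = -Q) :
    Nonempty (ℍ[ℚ, -Q, -(a * b)] ≃ₐ[ℚ] ℍ[ℚ, a, b]) := by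
  refine iso_of_elements (by linarith) (by nlinarith) ⟨0, x, y, 0⟩ ⟨0, 0, 0, 1⟩ ?_ ?_ ?_ <;>
    ext <;> simp <;> linarith

theorem iso_step2 {c d r m n : ℚ} (hc : c < 0) (hd : d < 0) (hr : r < 0)
    (h : r * d = m ^ 2 - c * n ^ 2) :
    Nonempty (ℍ[ℚ, c, r] ≃ₐ[ℚ] ℍ[ℚ, c, d]) := by
  refine iso_of_elements hc hr ⟨0, 1, 0, 0⟩ ⟨0, 0, m / d, n / d⟩ ?_ ?_ ?_
  · ext <;> simp
  · have := hd.ne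
    ext <;> simp
    · field_simp
      linarith
    all_goals ring
  · ext <;> simp <;> ring

theorem iso_step3 {p Q m n : ℚ} (hp : 0 < p) (hQ : 0 < Q) (h : Q = m ^ 2 + p * n ^ 2) :
    Nonempty (ℍ[ℚ, -1, -p] ≃ₐ[ℚ] ℍ[ℚ, -Q, -p]) := by
  refine iso_of_elements (by norm_num) (by linarith)
    ⟨0, m / Q, 0, n / Q⟩ ⟨0, 0, 1, 0⟩ ?_ ?_ ?_
  · have := hQ.ne'
    ext <;> simp
    · field_simp
      linarith
    all_goals ring
  · ext <;> simp
  · ext <;> simp <;> ring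



section Local
variable {p : ℕ} [hpf : Fact p.Prime]

/-- Bundle a `p`-adic number of norm at most one. -/
def mkI (x : ℚ_[p]) (h : ‖x‖ ≤ 1) : ℤ_[p] := ⟨x, h⟩

@[simp] theorem coe_mkI (x : ℚ_[p]) (h : ‖x‖ ≤ 1) : ((mkI x h : ℤ_[p]) : ℚ_[p]) = x := rfl

theorem norm_mkI (x : ℚ_[p]) (h : ‖x‖ ≤ 1) : ‖mkI x h‖ = ‖x‖ := rfl

/-- Residue of the unit part. -/
noncomputable def ures (x : ℚ_[p]) : ZMod p :=
  if h : ‖x * (p : ℚ_[p]) ^ (-x.valuation)‖ ≤ 1 then PadicInt.toZMod (mkI _ h) else 0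

theorem p_ne : (p : ℚ_[p]) ≠ 0 := by exact_mod_cast hpf.out.ne_zero

theorem norm_upart {x : ℚ_[p]} (hx : x ≠ 0) : ‖x * (p : ℚ_[p]) ^ (-x.valuation)‖ = 1 := by
  rw [norm_mul, Padic.norm_p_zpow, Padic.norm_eq_zpow_neg_valuation hx, neg_neg,
    ← zpow_add₀ (by exact_mod_cast hpf.out.ne_zero)]
  simp

theorem ures_eq {x : ℚ_[p]} (h : ‖x * (p : ℚ_[p]) ^ (-x.valuation)‖ ≤ 1) :
    ures x = PadicInt.toZMod (mkI _ h) := by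
  rw [ures, dif_pos h]

theorem toZMod_eq_zero_iff (x : ℤ_[p]) : PadicInt.toZMod x = 0 ↔ ‖x‖ < 1 := by
  rw [← RingHom.mem_ker, PadicInt.ker_toZMod, IsLocalRing.mem_maximalIdeal, PadicInt.mem_nonunits]

theorem ures_ne_zero {x : ℚ_[p]} (hx : x ≠ 0) : ures x ≠ 0 := by
  rw [ures_eq (norm_upart hx).le, Ne, toZMod_eq_zero_iff, norm_mkI, norm_upart hx]
  exact lt_irrefl _

theorem ures_mul {x y : ℚ_[p]} (hx : x ≠ 0) (hy : y ≠ 0) : ures (x * y) = ures x * ures y := by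
  rw [ures_eq (norm_upart hx).le, ures_eq (norm_upart hy).le,
    ures_eq (norm_upart (mul_ne_zero hx hy)).le, ← map_mul]
  congr 1
  apply PadicInt.ext
  simp only [PadicInt.coe_mul, coe_mkI]
  rw [Padic.valuation_mul hx hy, neg_add, zpow_add₀ p_ne]
  ring

theorem ures_unit (x : ℤ_[p]) (hx : ‖x‖ = 1) : ures (x : ℚ_[p]) = PadicInt.toZMod x := by
  have h0 : (x : ℚ_[p]) ≠ 0 := by
    intro h
    rw [PadicInt.norm_def, h] at hx
    simp at hx
  have hv : (x : ℚ_[p]).valuation = 0 := by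
    have := Padic.norm_eq_zpow_neg_valuation h0
    rw [← PadicInt.norm_def, hx] at this
    have h1 : (1:ℝ) < p := by exact_mod_cast hpf.out.one_lt
    have h2 := (zpow_eq_one_iff_right₀ (by linarith) h1.ne').1 this.symm
    omega
  rw [ures_eq (norm_upart h0).le]
  congr 1
  apply PadicInt.ext
  simp [hv]

theorem ures_int (n : ℤ) (hn : (n : ZMod p) ≠ 0) : ures (n : ℚ_[p]) = (n : ZMod p) := by
  have h : ‖(n : ℤ_[p])‖ = 1 := by
    apply le_antisymm (PadicInt.norm_le_one _)
    by_contra hlt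
    rw [not_le, ← toZMod_eq_zero_iff] at hlt
    simp at hlt
    exact hn hlt
  have := ures_unit (n : ℤ_[p]) h
  simpa using this

open Classical in
/-- Quadratic character of the unit part. -/
noncomputable def chi (x : ℚ_[p]) : ℤˣ := if IsSquare (ures x) then 1 else -1

theorem chi_coe {x : ℚ_[p]} (hx : x ≠ 0) : ((chi x : ℤˣ) : ℤ) = quadraticChar (ZMod p) (ures x) := by
  rw [quadraticChar_apply, quadraticCharFun, if_neg (ures_ne_zero hx), chi]
  split_ifs <;> simp

theorem chi_mul {x y : ℚ_[p]} (hx : x ≠ 0) (hy : y ≠ 0) : chi (x * y) = chi x * chi y := by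
  apply Units.ext
  rw [Units.val_mul, chi_coe hx, chi_coe hy, chi_coe (mul_ne_zero hx hy), ures_mul hx hy, map_mul]

theorem chi_sq (u : ℤˣ) : u * u = 1 := Int.units_mul_self u

theorem chi_int_eq_one_iff (n : ℤ) (hn : (n : ZMod p) ≠ 0) :
    chi (n : ℚ_[p]) = 1 ↔ IsSquare (n : ZMod p) := by
  rw [chi, ures_int n hn]
  split_ifs with h <;> simp [h]

theorem chi_one : chi (1 : ℚ_[p]) = 1 := by
  have := (chi_int_eq_one_iff (p := p) 1 (by simp)).2 (by simp)
  simpa using this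

/-- Tame symbol. -/
noncomputable def sym (a b : ℚ_[p]) : ℤˣ :=
  chi (-1 : ℚ_[p]) ^ (a.valuation * b.valuation) * chi a ^ b.valuation * chi b ^ a.valuation

theorem sym_comm (a b : ℚ_[p]) : sym a b = sym b a := by
  rw [sym, sym, mul_comm a.valuation]
  exact mul_right_comm _ _ _

theorem sym_mul (a : ℚ_[p]) {b c : ℚ_[p]} (hb : b ≠ 0) (hc : c ≠ 0) :
    sym a (b * c) = sym a b * sym a c := by
  simp only [sym, Padic.valuation_mul hb hc, chi_mul hb hc, mul_add, zpow_add, mul_zpow]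
  have key : ∀ x y z w s t : ℤˣ, x * y * (z * w) * (s * t) = x * z * s * (y * w * t) := by
    intros; ac_rfl
  exact key _ _ _ _ _ _

theorem units_pow_even (u : ℤˣ) {n : ℤ} (h : Even n) : u ^ n = 1 := by
  obtain ⟨k, rfl⟩ := h
  rw [zpow_add, chi_sq]

theorem units_pow_odd (u : ℤˣ) {n : ℤ} (h : Odd n) : u ^ n = u := by
  obtain ⟨k, rfl⟩ := h
  rw [zpow_add, zpow_one, units_pow_even _ (even_two_mul k), one_mul]

theorem sym_sq (a : ℚ_[p]) {b : ℚ_[p]} (hb : b ≠ 0) : sym a (b * b) = 1 := by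
  rw [sym_mul a hb hb, chi_sq]

theorem val_neg (a : ℚ_[p]) : (-a).valuation = a.valuation := by
  by_cases h : a = 0
  · simp [h]
  have h1 : (-a) * (-a) = a * a := by ring
  have h2 := congrArg Padic.valuation h1
  rw [Padic.valuation_mul h h, Padic.valuation_mul (neg_ne_zero.2 h) (neg_ne_zero.2 h)] at h2
  omega

theorem chi_neg {a : ℚ_[p]} (ha : a ≠ 0) : chi (-a) = chi (-1 : ℚ_[p]) * chi a := by
  rw [← chi_mul (by simp) ha]; simp

theorem sym_ee {a b : ℚ_[p]} (ha : Even a.valuation) (hb : Even b.valuation) : sym a b = 1 := by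
  rw [sym, units_pow_even _ ha, units_pow_even _ hb, units_pow_even _ (ha.mul_right _)]; simp

theorem sym_eo {a b : ℚ_[p]} (ha : Even a.valuation) (hb : Odd b.valuation) : sym a b = chi a := by
  rw [sym, units_pow_even _ ha, units_pow_odd _ hb, units_pow_even _ (ha.mul_right _)]; simp

theorem sym_oo {a b : ℚ_[p]} (ha0 : a ≠ 0) (hb0 : b ≠ 0) (ha : Odd a.valuation)
    (hb : Odd b.valuation) : sym a b = chi (-(a * b)) := by
  rw [sym, units_pow_odd _ ha, units_pow_odd _ hb, units_pow_odd _ (ha.mul hb),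
    chi_neg (mul_ne_zero ha0 hb0), chi_mul ha0 hb0, mul_assoc]

theorem sym_neg_self {a : ℚ_[p]} (ha : a ≠ 0) : sym a (-a) = 1 := by
  rcases Int.even_or_odd a.valuation with h | h
  · exact sym_ee h (by rwa [val_neg])
  · rw [sym_oo ha (neg_ne_zero.2 ha) h (by rwa [val_neg])]
    rw [show -(a * -a) = a * a by ring, chi_mul ha ha, chi_sq]

theorem sym_neg_mul {a b : ℚ_[p]} (ha : a ≠ 0) (hb : b ≠ 0) : sym a (-(a * b)) = sym a b := by
  rw [show -(a * b) = (-a) * b by ring, sym_mul a (neg_ne_zero.2 ha) hb, sym_neg_self ha, one_mul]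

/-- `1 + small` has trivial character -/
theorem chi_eq_of_lt {x y : ℚ_[p]} (hx : x ≠ 0) (hxy : ‖x - y‖ < ‖x‖) : chi x = chi y := by
  have hy : y ≠ 0 := by
    rintro rfl
    simp at hxy
  have hx' : 0 < ‖x‖ := norm_pos_iff.2 hx
  have hlt : ‖(x - y) / x‖ < 1 := by
    rw [norm_div, div_lt_one hx']; exact hxy
  let e : ℤ_[p] := mkI ((x - y) / x) hlt.le
  have he : ‖e‖ < 1 := hlt
  have h1 : PadicInt.toZMod (1 - e) = 1 := by
    rw [map_sub, (toZMod_eq_zero_iff e).2 he]; simp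
  have h2 : ‖1 - e‖ = 1 := by
    apply le_antisymm (PadicInt.norm_le_one _)
    by_contra hlt
    rw [not_le, ← toZMod_eq_zero_iff, h1] at hlt
    exact one_ne_zero hlt
  have h3 : ((1 - e : ℤ_[p]) : ℚ_[p]) = y / x := by
    rw [PadicInt.coe_sub, coe_mkI, PadicInt.coe_one]; field_simp; ring
  have h4 := ures_unit _ h2
  rw [h3, h1] at h4
  have h5 : chi (y / x) = 1 := by rw [chi, h4, if_pos (by simp)]
  have h6 := chi_mul (div_ne_zero hy hx) hx
  rw [div_mul_cancel₀ _ hx, h5, one_mul] at h6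
  exact h6.symm

theorem norm_lt_iff {x y : ℚ_[p]} (hx : x ≠ 0) (hy : y ≠ 0) :
    ‖x‖ < ‖y‖ ↔ y.valuation < x.valuation := by
  rw [Padic.norm_eq_zpow_neg_valuation hx, Padic.norm_eq_zpow_neg_valuation hy,
    zpow_lt_zpow_iff_right₀ (by exact_mod_cast hpf.out.one_lt)]
  omega

theorem norm_eq_iff {x y : ℚ_[p]} (hx : x ≠ 0) (hy : y ≠ 0) :
    ‖x‖ = ‖y‖ ↔ y.valuation = x.valuation := by
  have h1 := norm_lt_iff hx hy
  have h2 := norm_lt_iff hy hx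
  constructor
  · intro h
    rw [h] at h1 h2
    simp at h1 h2
    omega
  · intro h
    rw [h] at h1 h2
    simp at h1 h2
    exact le_antisymm h2 h1

/-- norm form of an unramified extension has even valuation. -/
theorem even_val {a x y : ℚ_[p]} (ha0 : a ≠ 0) (ha : Even a.valuation) (hc : chi a = -1)
    (hxy : ¬ (x = 0 ∧ y = 0)) : x * x - a * (y * y) ≠ 0 ∧ Even (x * x - a * (y * y)).valuation := by
  by_cases hx : x = 0
  · have hy : y ≠ 0 := fun h => hxy ⟨hx, h⟩
    have h0 : a * (y * y) ≠ 0 := mul_ne_zero ha0 (mul_ne_zero hy hy)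
    subst hx
    rw [mul_zero, zero_sub, val_neg]
    refine ⟨neg_ne_zero.2 h0, ?_⟩
    rw [Padic.valuation_mul ha0 (mul_ne_zero hy hy), Padic.valuation_mul hy hy]
    exact ha.add ⟨_, rfl⟩
  by_cases hy : y = 0
  · subst hy
    simp only [mul_zero, sub_zero]
    refine ⟨mul_ne_zero hx hx, ?_⟩
    rw [Padic.valuation_mul hx hx]
    exact ⟨_, rfl⟩
  have h0 : a * (y * y) ≠ 0 := mul_ne_zero ha0 (mul_ne_zero hy hy)
  have h1 : x * x ≠ 0 := mul_ne_zero hx hx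
  have e0 : Even (a * (y * y)).valuation := by
    rw [Padic.valuation_mul ha0 (mul_ne_zero hy hy), Padic.valuation_mul hy hy]
    exact ha.add ⟨_, rfl⟩
  have e1 : Even (x * x).valuation := by
    rw [Padic.valuation_mul hx hx]
    exact ⟨_, rfl⟩
  have c0 : chi (a * (y * y)) = -1 := by
    rw [chi_mul ha0 (mul_ne_zero hy hy), chi_mul hy hy, chi_sq, hc]; rfl
  have c1 : chi (x * x) = 1 := by rw [chi_mul hx hx, chi_sq]
  set s := x * x
  set t := a * (y * y)
  have hn1 : ¬ ‖s - t‖ < ‖s‖ := by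
    intro h
    have := chi_eq_of_lt h1 h
    rw [c0, c1] at this
    exact absurd this (by decide)
  have hn2 : ¬ ‖s - t‖ < ‖t‖ := by
    intro h
    rw [← norm_neg, neg_sub] at h
    have := chi_eq_of_lt h0 h
    rw [c0, c1] at this
    exact absurd this (by decide)
  have hne : s - t ≠ 0 := by
    intro h
    rw [h, norm_zero] at hn1
    exact hn1 (norm_pos_iff.2 h1)
  refine ⟨hne, ?_⟩
  have hle : ‖s - t‖ ≤ max ‖s‖ ‖t‖ := by
    rw [sub_eq_add_neg, ← norm_neg t]; exact Padic.nonarchimedean _ _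
  rcases le_max_iff.1 hle with h | h
  · have := le_antisymm h (not_lt.1 hn1)
    rw [norm_eq_iff hne h1] at this
    rwa [← this]
  · have := le_antisymm h (not_lt.1 hn2)
    rw [norm_eq_iff hne h0] at this
    rwa [← this]

/-- Isotropy of the norm form. -/
def Iso (a b : ℚ_[p]) : Prop :=
  ∃ x y z w : ℚ_[p], ¬ (x = 0 ∧ y = 0 ∧ z = 0 ∧ w = 0) ∧
    x * x - a * (y * y) - b * (z * z) + a * b * (w * w) = 0

theorem not_iso_core {a b : ℚ_[p]} (ha0 : a ≠ 0) (hb0 : b ≠ 0) (ha : Even a.valuation)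
    (hc : chi a = -1) (hb : Odd b.valuation) : ¬ Iso a b := by
  rintro ⟨x, y, z, w, hne, h⟩
  have h' : x * x - a * (y * y) = b * (z * z - a * (w * w)) := by linear_combination h
  by_cases hzw : z = 0 ∧ w = 0
  · have hxy : ¬ (x = 0 ∧ y = 0) := fun hh => hne ⟨hh.1, hh.2, hzw.1, hzw.2⟩
    apply (even_val ha0 ha hc hxy).1
    rw [h', hzw.1, hzw.2]; ring
  · obtain ⟨f1, f2⟩ := even_val ha0 ha hc hzw
    have f3 : x * x - a * (y * y) ≠ 0 := by rw [h']; exact mul_ne_zero hb0 f1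
    have hxy : ¬ (x = 0 ∧ y = 0) := by
      rintro ⟨rfl, rfl⟩
      simp at f3
    obtain ⟨-, g2⟩ := even_val ha0 ha hc hxy
    rw [h', Padic.valuation_mul hb0 f1] at g2
    rw [Int.even_add] at g2
    exact (Int.not_even_iff_odd.2 hb) (g2.2 f2)

theorem Iso.swap {a b : ℚ_[p]} (h : Iso a b) : Iso b a := by
  obtain ⟨x, y, z, w, hne, h⟩ := h
  exact ⟨x, z, y, w, by tauto, by linear_combination h⟩

theorem Iso.third {a b : ℚ_[p]} (hb : b ≠ 0) (h : Iso a b) : Iso (-(a * b)) b := by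
  obtain ⟨x, y, z, w, hne, h⟩ := h
  refine ⟨x, w, z, y / b, ?_, ?_⟩
  · simp only [div_eq_zero_iff, hb, or_false]
    tauto
  · field_simp
    linear_combination h

theorem sym_eq_one_of_iso {a b : ℚ_[p]} (ha0 : a ≠ 0) (hb0 : b ≠ 0) (h : Iso a b) :
    sym a b = 1 := by
  by_contra hs
  have hs : sym a b = -1 := (Int.units_eq_one_or _).resolve_left hs
  rcases Int.even_or_odd a.valuation with ha | ha <;> rcases Int.even_or_odd b.valuation with hb | hb
  · rw [sym_ee ha hb] at hs; exact absurd hs (by decide)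
  · rw [sym_eo ha hb] at hs
    exact not_iso_core ha0 hb0 ha hs hb h
  · rw [sym_comm, sym_eo hb ha] at hs
    exact not_iso_core hb0 ha0 hb hs ha h.swap
  · rw [sym_oo ha0 hb0 ha hb] at hs
    have hab := mul_ne_zero ha0 hb0
    refine not_iso_core (neg_ne_zero.2 hab) hb0 ?_ hs hb (h.third hb0)
    rw [val_neg, Padic.valuation_mul ha0 hb0]
    exact ha.add_odd hb

/-- Steinberg-type relation. -/
theorem sym_norm {a b x : ℚ_[p]} (ha0 : a ≠ 0) (hb0 : b ≠ 0) (h : b = x * x - a) :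
    sym a b = 1 :=
  sym_eq_one_of_iso ha0 hb0 ⟨x, 1, 1, 0, by simp, by rw [h]; ring⟩

/-- Hensel: squares. -/
theorem isSquare_of_chi (h2 : p ≠ 2) {a : ℚ_[p]} (ha0 : a ≠ 0) (ha : Even a.valuation)
    (hc : chi a = 1) : ∃ s, a = s * s := by
  obtain ⟨k, hk⟩ := ha
  let u : ℤ_[p] := mkI _ (norm_upart ha0).le
  have hu : PadicInt.toZMod u = ures a := (ures_eq (norm_upart ha0).le).symm
  have hsq : IsSquare (PadicInt.toZMod u) := by
    rw [hu]
    by_contra hh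
    rw [chi, if_neg hh] at hc
    exact absurd hc (by decide)
  have hu0 : PadicInt.toZMod u ≠ 0 := by rw [hu]; exact ures_ne_zero ha0
  obtain ⟨r, hr⟩ := hsq
  obtain ⟨t, rfl⟩ : ∃ t : ℤ_[p], PadicInt.toZMod t = r :=
    ⟨(r.val : ℤ_[p]), by rw [map_natCast, ZMod.natCast_zmod_val]⟩
  have ht0 : PadicInt.toZMod t ≠ 0 := by
    intro h
    rw [h, mul_zero] at hr
    exact hu0 hr
  have h20 : (2 : ZMod p) ≠ 0 := by
    intro h
    have : ((2 : ℕ) : ZMod p) = 0 := by exact_mod_cast h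
    rw [ZMod.natCast_eq_zero_iff] at this
    exact h2 ((Nat.prime_dvd_prime_iff_eq hpf.out Nat.prime_two).1 this)
  have hd : ‖2 * t‖ = 1 := by
    apply le_antisymm (PadicInt.norm_le_one _)
    by_contra hlt
    rw [not_le, ← toZMod_eq_zero_iff, map_mul, map_ofNat] at hlt
    exact mul_ne_zero h20 ht0 hlt
  have hz : ‖t ^ 2 - u‖ < 1 := by
    rw [← toZMod_eq_zero_iff, map_sub, map_pow, hr]; ring
  obtain ⟨z, hz, -⟩ := hensels_lemma (F := (Polynomial.X ^ 2 - Polynomial.C u : Polynomial ℤ_[p]))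
    (a := t) (by
      have e1 : (Polynomial.X ^ 2 - Polynomial.C u : Polynomial ℤ_[p]).derivative.aeval t = 2 * t := by
        simp [one_add_one_eq_two]
      rw [e1, hd]
      simpa using hz)
  have hz' : z ^ 2 = u := by
    have : z ^ 2 - u = 0 := by simpa using hz
    exact sub_eq_zero.1 this
  refine ⟨z * (p : ℚ_[p]) ^ k, ?_⟩
  have h3 : ((z : ℚ_[p])) ^ 2 = a * (p : ℚ_[p]) ^ (-a.valuation) := by
    have := congrArg (fun x : ℤ_[p] => (x : ℚ_[p])) hz'
    simpa [u] using this
  calc a = a * (p : ℚ_[p]) ^ (-a.valuation) * ((p : ℚ_[p]) ^ k * (p : ℚ_[p]) ^ k) := by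
        rw [← zpow_add₀ p_ne, ← hk, mul_assoc, ← zpow_add₀ p_ne]; simp
    _ = _ := by rw [← h3]; ring

theorem iso_of_sq {a b s : ℚ_[p]} (h : a = s * s) : Iso a b :=
  ⟨s, 1, 0, 0, by simp, by rw [h]; ring⟩

theorem iso_of_third_sq {a b s : ℚ_[p]} (h : -(a * b) = s * s) : Iso a b :=
  ⟨s, 0, 0, 1, by simp, by rw [← h]; ring⟩

theorem neg_one_sum (h3 : p % 4 = 3) : ∃ s t : ℚ_[p], -1 = s * s + t * t := by
  have h2 : p ≠ 2 := by omega
  have hns : ¬ IsSquare (-1 : ZMod p) := by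
    rw [ZMod.exists_sq_eq_neg_one_iff]; omega
  obtain ⟨x, y, hxy⟩ := ZMod.sq_add_sq p (-1 : ZMod p)
  have hx : x ≠ 0 := by
    rintro rfl
    exact hns ⟨y, by rw [← hxy]; ring⟩
  have hc : ((-1 - (y.val : ℤ) ^ 2 : ℤ) : ZMod p) = x * x := by
    push_cast
    rw [ZMod.natCast_zmod_val, ← hxy]; ring
  have hne : ((-1 - (y.val : ℤ) ^ 2 : ℤ) : ZMod p) ≠ 0 := by
    rw [hc]; exact mul_ne_zero hx hx
  have h1 := (chi_int_eq_one_iff _ hne).2 ⟨x, hc⟩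
  have hv : ((-1 - (y.val : ℤ) ^ 2 : ℤ) : ℚ_[p]).valuation = 0 := by
    rw [Padic.valuation_intCast, padicValInt.eq_zero_of_not_dvd]
    · rfl
    · rwa [← ZMod.intCast_zmod_eq_zero_iff_dvd] 
  have h0 : ((-1 - (y.val : ℤ) ^ 2 : ℤ) : ℚ_[p]) ≠ 0 := by
    intro h
    have : (-1 - (y.val : ℤ) ^ 2 : ℤ) = 0 := by exact_mod_cast h
    rw [this] at hne
    simp at hne
  obtain ⟨s, hs⟩ := isSquare_of_chi h2 h0 (by rw [hv]; exact Even.zero) h1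
  refine ⟨s, (y.val : ℚ_[p]), ?_⟩
  rw [← hs]; push_cast; ring

theorem iso_of_sym (h3 : p % 4 = 3) {a b : ℚ_[p]} (ha0 : a ≠ 0) (hb0 : b ≠ 0)
    (h : sym a b = 1) : Iso a b := by
  have h2 : p ≠ 2 := by omega
  have hab := neg_ne_zero.2 (mul_ne_zero ha0 hb0)
  rcases Int.even_or_odd a.valuation with ha | ha <;> rcases Int.even_or_odd b.valuation with hb | hb
  · by_cases ca : chi a = 1
    · obtain ⟨s, hs⟩ := isSquare_of_chi h2 ha0 ha ca
      exact iso_of_sq hs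
    by_cases cb : chi b = 1
    · obtain ⟨s, hs⟩ := isSquare_of_chi h2 hb0 hb cb
      exact (iso_of_sq hs).swap
    have ca := (Int.units_eq_one_or _).resolve_left ca
    have cb := (Int.units_eq_one_or _).resolve_left cb
    have c1 : chi (-1 : ℚ_[p]) = -1 := by
      refine (Int.units_eq_one_or _).resolve_left ?_
      intro hh
      have := (chi_int_eq_one_iff (p := p) (-1) (by simp)).1 (by simpa using hh)
      rw [Int.cast_neg, Int.cast_one, ZMod.exists_sq_eq_neg_one_iff] at this
      omega
    obtain ⟨s, hs⟩ := isSquare_of_chi h2 (neg_ne_zero.2 ha0) (by rwa [val_neg])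
      (by rw [chi_neg ha0, ca, c1]; rfl)
    obtain ⟨t, ht⟩ := isSquare_of_chi h2 (neg_ne_zero.2 hb0) (by rwa [val_neg])
      (by rw [chi_neg hb0, cb, c1]; rfl)
    have hs0 : s ≠ 0 := by rintro rfl; simp at hs; exact ha0 hs
    have ht0 : t ≠ 0 := by rintro rfl; simp at ht; exact hb0 ht
    obtain ⟨m, n, hmn⟩ := neg_one_sum h3
    refine ⟨1, m / s, n / t, 0, by simp, ?_⟩
    rw [show a = -(s * s) by rw [← hs]; ring, show b = -(t * t) by rw [← ht]; ring]
    field_simp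
    linear_combination -hmn
  · rw [sym_eo ha hb] at h
    obtain ⟨s, hs⟩ := isSquare_of_chi h2 ha0 ha h
    exact iso_of_sq hs
  · rw [sym_comm, sym_eo hb ha] at h
    obtain ⟨s, hs⟩ := isSquare_of_chi h2 hb0 hb h
    exact (iso_of_sq hs).swap
  · rw [sym_oo ha0 hb0 ha hb] at h
    obtain ⟨s, hs⟩ := isSquare_of_chi h2 hab
      (by rw [val_neg, Padic.valuation_mul ha0 hb0]; exact ha.add_odd hb) h
    exact iso_of_third_sq hs

end Local

/-! ### Legendre's theorem -/

/-- All odd tame symbols are trivial. -/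
def Loc (a b : ℚ) : Prop :=
  ∀ (l : ℕ) (_ : Fact l.Prime), l ≠ 2 → sym (a : ℚ_[l]) (b : ℚ_[l]) = 1

/-- Solvability of `z² = a x² + b y²`. -/
def Sol (a b : ℚ) : Prop :=
  ∃ x y z : ℚ, ¬ (x = 0 ∧ y = 0 ∧ z = 0) ∧ z * z = a * (x * x) + b * (y * y)

theorem Loc.swap {a b : ℚ} (h : Loc a b) : Loc b a := by
  intro l hl h2
  rw [sym_comm]
  exact h l hl h2

theorem Sol.swap {a b : ℚ} (h : Sol a b) : Sol b a := by
  obtain ⟨x, y, z, h1, h2⟩ := h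
  exact ⟨y, x, z, by tauto, by linarith⟩

theorem ratCast_ne {l : ℕ} [Fact l.Prime] {a : ℚ} (ha : a ≠ 0) : (a : ℚ_[l]) ≠ 0 := by
  exact_mod_cast ha

theorem Loc.sq_mul {a b d : ℚ} (hb : b ≠ 0) (hd : d ≠ 0) : Loc a (b * (d * d)) ↔ Loc a b := by
  unfold Loc
  refine forall_congr' fun l => forall_congr' fun hl => forall_congr' fun _ => ?_
  push_cast
  have h1 := ratCast_ne (l := l) hb
  have h2 := ratCast_ne (l := l) hd
  rw [sym_mul _ h1 (mul_ne_zero h2 h2), sym_sq _ h2, mul_one]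

theorem Sol.sq_mul {a b d : ℚ} (hd : d ≠ 0) (h : Sol a (b * (d * d))) : Sol a b := by
  obtain ⟨x, y, z, h1, h2⟩ := h
  refine ⟨x, y * d, z, ?_, ?_⟩
  · simp only [mul_eq_zero, hd, or_false]; exact h1
  · rw [h2]; ring

theorem Sol.sq_mul' {a b d : ℚ} (hd : d ≠ 0) (h : Sol a b) : Sol a (b * (d * d)) := by
  apply Sol.sq_mul (d := d⁻¹) (inv_ne_zero hd)
  rwa [show b * (d * d) * (d⁻¹ * d⁻¹) = b by field_simp]

theorem crt_sq (a : ℤ) (n : ℕ) : Squarefree n →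
    (∀ l : ℕ, l.Prime → l ∣ n → ∃ t : ℤ, (l : ℤ) ∣ t * t - a) → ∃ t : ℤ, (n : ℤ) ∣ t * t - a := by
  induction n using induction_on_primes with
  | zero => intro h; exact absurd h (by simp)
  | one => intro _ _; exact ⟨0, by simp⟩
  | prime_mul l m hl ih =>
    intro hs h
    rw [Nat.squarefree_mul_iff] at hs
    obtain ⟨t2, s2, h2⟩ := ih hs.2.2 (fun l hl hd => h l hl (hd.mul_left _))
    obtain ⟨t1, s1, h1⟩ := h l hl (Dvd.intro _ rfl)
    obtain ⟨r, s, hrs⟩ := Nat.isCoprime_iff_coprime.2 hs.1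
    refine ⟨t1 * s * m + t2 * r * l, ?_⟩
    have hc : IsCoprime (l : ℤ) (m : ℤ) := ⟨r, s, hrs⟩
    push_cast
    apply hc.mul_dvd
    · have e : t1 * s * m + t2 * r * l = t1 + l * (r * (t2 - t1)) := by
        linear_combination t1 * hrs
      rw [e]
      exact ⟨s1 + 2 * t1 * (r * (t2 - t1)) + l * (r * (t2 - t1)) ^ 2, by linear_combination h1⟩
    · have e : t1 * s * m + t2 * r * l = t2 + m * (s * (t1 - t2)) := by
        linear_combination t2 * hrs
      rw [e]
      exact ⟨s2 + 2 * t2 * (s * (t1 - t2)) + m * (s * (t1 - t2)) ^ 2, by linear_combination h2⟩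

theorem val_int_unit {l : ℕ} [Fact l.Prime] {n : ℤ} (h : (n : ZMod l) ≠ 0) :
    (n : ℚ_[l]).valuation = 0 := by
  rw [Padic.valuation_intCast, padicValInt.eq_zero_of_not_dvd]
  · rfl
  · rwa [← ZMod.intCast_zmod_eq_zero_iff_dvd]

theorem val_int_prime {l : ℕ} [hl : Fact l.Prime] {n : ℤ} (h : (n : ZMod l) ≠ 0) :
    ((l * n : ℤ) : ℚ_[l]).valuation = 1 := by
  have hn : (n : ℚ_[l]) ≠ 0 := by
    intro h0
    have : n = 0 := by exact_mod_cast h0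
    exact h (by simp [this])
  push_cast
  rw [Padic.valuation_mul p_ne hn, Padic.valuation_p, val_int_unit h]; rfl

/-- Descent step for Legendre's theorem. -/
theorem legendre_step (n : ℕ)
    (ih : ∀ a b : ℤ, a ≠ 0 → b ≠ 0 → (0 < a ∨ 0 < b) → Loc a b → a.natAbs + b.natAbs < n →
      Sol a b) (a b : ℤ) (ha : a ≠ 0) (hb : b ≠ 0) (hpos : 0 < a ∨ 0 < b) (hloc : Loc a b)
    (hn : a.natAbs + b.natAbs = n) (hab : a.natAbs ≤ b.natAbs) : Sol a b := by
  by_cases hsf : Squarefree b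
  swap
  · -- remove a square factor
    obtain ⟨d, ⟨c, hc⟩, hd⟩ : ∃ d, d * d ∣ b ∧ ¬ IsUnit d := by
      simpa [Squarefree] using hsf
    have hd0 : d ≠ 0 := by rintro rfl; simp at hc; exact hb hc
    have hc0 : c ≠ 0 := by rintro rfl; simp at hc; exact hb hc
    have hdq : (d : ℚ) ≠ 0 := by exact_mod_cast hd0
    have hcq : (c : ℚ) ≠ 0 := by exact_mod_cast hc0
    have hbq : (b : ℚ) = c * (d * d) := by rw [hc]; push_cast; ring
    rw [hbq] at hloc ⊢
    apply Sol.sq_mul' hdq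
    apply ih a c ha hc0 _ ((Loc.sq_mul hcq hdq).1 hloc)
    · have h1 : 2 ≤ d.natAbs := by
        rw [Int.isUnit_iff_natAbs_eq] at hd
        have := Int.natAbs_pos.2 hd0
        omega
      have h2 : b.natAbs = d.natAbs * d.natAbs * c.natAbs := by rw [hc, Int.natAbs_mul, Int.natAbs_mul]
      have h3 : 0 < c.natAbs := Int.natAbs_pos.2 hc0
      have h5 : 2 * 2 ≤ d.natAbs * d.natAbs := Nat.mul_le_mul h1 h1
      have h4 : c.natAbs < b.natAbs := by rw [h2]; nlinarith
      omega
    · rcases hpos with h | h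
      · exact Or.inl h
      · right
        rw [hc] at h
        exact pos_of_mul_pos_right h (mul_self_nonneg d)
  by_cases hb1 : b.natAbs = 1
  · have ha1 : a.natAbs = 1 := by have := Int.natAbs_pos.2 ha; omega
    rcases hpos with h | h
    · have : a = 1 := by omega
      exact ⟨1, 0, 1, by simp, by simp [this]⟩
    · have : b = 1 := by omega
      exact ⟨0, 1, 1, by simp, by simp [this]⟩
  have hN : 2 ≤ b.natAbs := by have := Int.natAbs_pos.2 hb; omega
  -- `a` is a square modulo `b`
  obtain ⟨t0, ht0⟩ := crt_sq a b.natAbs (Int.squarefree_natAbs.2 hsf) (by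
    intro l hl hd
    have : Fact l.Prime := ⟨hl⟩
    by_cases hl2 : l = 2
    · subst hl2
      refine ⟨a, ?_⟩
      have := Int.even_mul_pred_self a
      rw [show a * a - a = a * (a - 1) by ring]
      exact_mod_cast this.two_dvd
    by_cases hla : (a : ZMod l) = 0
    · refine ⟨0, ?_⟩
      rw [ZMod.intCast_zmod_eq_zero_iff_dvd] at hla
      simpa using hla
    obtain ⟨c, hc⟩ := Int.natCast_dvd.2 hd
    have hcl : (c : ZMod l) ≠ 0 := by
      rw [Ne, ZMod.intCast_zmod_eq_zero_iff_dvd]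
      rintro ⟨e, rfl⟩
      have := hsf l ⟨e, by rw [hc]; ring⟩
      rw [Int.isUnit_iff_natAbs_eq, Int.natAbs_natCast] at this
      exact hl.one_lt.ne' this
    have hs := hloc l inferInstance hl2
    push_cast at hs
    rw [sym_eo (by rw [val_int_unit hla]; exact Even.zero)
      (by rw [hc, val_int_prime hcl]; exact odd_one), chi_int_eq_one_iff _ hla] at hs
    obtain ⟨r, hr⟩ := hs
    refine ⟨(r.val : ℤ), ?_⟩
    rw [← ZMod.intCast_zmod_eq_zero_iff_dvd]
    push_cast
    rw [ZMod.natCast_zmod_val, hr, sub_self])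
  -- choose a small root
  obtain ⟨t, ht, htl⟩ : ∃ t : ℤ, b ∣ t * t - a ∧ 2 * t.natAbs ≤ b.natAbs := by
    refine ⟨Int.bmod t0 b.natAbs, ?_, ?_⟩
    · obtain ⟨k, hk⟩ : (b.natAbs : ℤ) ∣ t0 - Int.bmod t0 b.natAbs := Int.dvd_self_sub_bmod
      rw [← Int.natAbs_dvd]
      obtain ⟨s, hs⟩ := ht0
      refine ⟨s - k * (t0 + Int.bmod t0 b.natAbs), ?_⟩
      linear_combination hs - (t0 + Int.bmod t0 b.natAbs) * hk
    · have h1 := @Int.le_bmod t0 b.natAbs (by omega)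
      have h2 := @Int.bmod_lt t0 b.natAbs (by omega)
      omega
  obtain ⟨c, hc⟩ := ht
  by_cases hc0 : c = 0
  · rw [hc0, mul_zero] at hc
    refine ⟨1, 0, t, by simp, ?_⟩
    have : t * t = a := by linarith
    rw [← this]; push_cast; ring
  have hcb : c.natAbs < b.natAbs := by
    have h1 : b.natAbs * c.natAbs ≤ t.natAbs * t.natAbs + a.natAbs := by
      rw [← Int.natAbs_mul, ← hc, ← Int.natAbs_mul]
      exact Int.natAbs_sub_le _ _
    by_contra hlt
    push Not at hlt
    have h2 : b.natAbs * b.natAbs ≤ b.natAbs * c.natAbs := Nat.mul_le_mul_left _ hlt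
    have h3 : (2 * t.natAbs) * (2 * t.natAbs) ≤ b.natAbs * b.natAbs := Nat.mul_le_mul htl htl
    nlinarith
  have hcq : (c : ℚ) ≠ 0 := by exact_mod_cast hc0
  have hbc : (b : ℚ) * c = t * t - a := by exact_mod_cast hc.symm
  have hloc' : Loc a c := by
    intro l hl hl2
    have h1 := hloc l hl hl2
    have haq : ((a : ℚ) : ℚ_[l]) ≠ 0 := ratCast_ne (by exact_mod_cast ha)
    have hbq : ((b : ℚ) : ℚ_[l]) ≠ 0 := ratCast_ne (by exact_mod_cast hb)
    have hcq' : ((c : ℚ) : ℚ_[l]) ≠ 0 := ratCast_ne hcq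
    have h2 : sym ((a : ℚ) : ℚ_[l]) (((b : ℚ) : ℚ_[l]) * ((c : ℚ) : ℚ_[l])) = 1 := by
      apply sym_norm haq (mul_ne_zero hbq hcq') (x := ((t : ℚ) : ℚ_[l]))
      exact_mod_cast hbc
    rwa [sym_mul _ hbq hcq', h1, one_mul] at h2
  have hsol := ih a c ha hc0 (by
    by_contra hneg
    push Not at hneg
    have hb' : 0 < b := hpos.resolve_left (not_lt.2 hneg.1)
    have h1 : b * c ≤ 0 := mul_nonpos_of_nonneg_of_nonpos hb'.le hneg.2
    have h2 : a < 0 := lt_of_le_of_ne hneg.1 ha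
    nlinarith [mul_self_nonneg t]) hloc' (by omega)
  obtain ⟨x, y, z, h1, h2⟩ := hsol
  by_cases hy : y = 0
  · subst hy
    exact ⟨x, 0, z, h1, by simpa using h2⟩
  refine ⟨z + x * t, c * y, z * t + a * x, ?_, ?_⟩
  · rintro ⟨-, h, -⟩
    exact mul_ne_zero hcq hy h
  · linear_combination (t * t - a : ℚ) * h2 - (c * y * y) * hbc

theorem legendre_int (a b : ℤ) (ha : a ≠ 0) (hb : b ≠ 0) (hpos : 0 < a ∨ 0 < b)
    (hloc : Loc a b) : Sol a b := by
  obtain ⟨n, hn⟩ : ∃ n, a.natAbs + b.natAbs = n := ⟨_, rfl⟩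
  induction n using Nat.strong_induction_on generalizing a b with
  | _ n ih =>
    have ih' : ∀ a b : ℤ, a ≠ 0 → b ≠ 0 → (0 < a ∨ 0 < b) → Loc a b → a.natAbs + b.natAbs < n →
      Sol a b := fun a b h1 h2 h3 h4 h5 => ih _ h5 a b h1 h2 h3 h4 rfl
    rcases le_total a.natAbs b.natAbs with h | h
    · exact legendre_step n ih' a b ha hb hpos hloc hn h
    · exact (legendre_step n ih' b a hb ha hpos.symm hloc.swap (by omega) h).swap

theorem num_den (a : ℚ) : ((a.num * a.den : ℤ) : ℚ) = a * ((a.den : ℚ) * a.den) := by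
  push_cast
  have := Rat.mul_den_eq_num a
  rw [← this]; ring

theorem legendre_rat (a b : ℚ) (ha : a ≠ 0) (hb : b ≠ 0) (hpos : 0 < a ∨ 0 < b)
    (hloc : Loc a b) : Sol a b := by
  have hda : (a.den : ℚ) ≠ 0 := by exact_mod_cast a.den_ne_zero
  have hdb : (b.den : ℚ) ≠ 0 := by exact_mod_cast b.den_ne_zero
  apply Sol.sq_mul hdb
  apply Sol.swap
  apply Sol.sq_mul hda
  rw [← num_den, ← num_den]
  apply Sol.swap
  apply legendre_int
  · exact mul_ne_zero (Rat.num_ne_zero.2 ha) (by exact_mod_cast a.den_ne_zero)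
  · exact mul_ne_zero (Rat.num_ne_zero.2 hb) (by exact_mod_cast b.den_ne_zero)
  · rcases hpos with h | h
    · exact Or.inl (mul_pos (Rat.num_pos.2 h) (by exact_mod_cast a.den_pos))
    · exact Or.inr (mul_pos (Rat.num_pos.2 h) (by exact_mod_cast b.den_pos))
  · rw [num_den, num_den]
    rw [Loc.sq_mul hb hdb]
    apply Loc.swap
    rw [Loc.sq_mul ha hda]
    exact hloc.swap

/-! ### Symbol computations -/

theorem sym_int_units {l : ℕ} [Fact l.Prime] {m n : ℤ} (hm : (m : ZMod l) ≠ 0)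
    (hn : (n : ZMod l) ≠ 0) : sym (m : ℚ_[l]) (n : ℚ_[l]) = 1 :=
  sym_ee (by rw [val_int_unit hm]; exact Even.zero) (by rw [val_int_unit hn]; exact Even.zero)

theorem sym_int_sq {l : ℕ} [Fact l.Prime] {m : ℤ} (hm : (m : ZMod l) ≠ 0)
    (hs : IsSquare (m : ZMod l)) (b : ℚ_[l]) : sym (m : ℚ_[l]) b = 1 := by
  have he : Even (m : ℚ_[l]).valuation := by rw [val_int_unit hm]; exact Even.zero
  rcases Int.even_or_odd b.valuation with hb | hb
  · exact sym_ee he hb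
  · rw [sym_eo he hb, chi_int_eq_one_iff _ hm]; exact hs

theorem sym_qq {l : ℕ} [Fact l.Prime] {a b q : ℚ_[l]} (ha : a ≠ 0) (hb : b ≠ 0) (hq : q ≠ 0) :
    sym (a * q) (b * q) = sym a b * sym q (-(a * b)) := by
  have h1 : sym q q = sym q (-1) := by
    have h := sym_mul q (b := -q) (c := -1) (neg_ne_zero.2 hq) (by simp)
    rw [sym_neg_self hq, one_mul] at h
    rw [← h]; congr 1; ring
  rw [sym_mul _ hb hq, sym_comm (a * q) b, sym_comm (a * q) q, sym_mul _ ha hq, sym_mul _ ha hq,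
    show -(a * b) = (a * b) * (-1) by ring, sym_mul _ (mul_ne_zero ha hb) (by simp),
    sym_mul _ ha hb, sym_comm b a, sym_comm b q, h1]
  generalize sym a b = x1, sym q b = x2, sym q a = x3, sym q (-1) = x4
  ac_rfl

open NumberTheorySymbols in
theorem isSquare_m {m Q : ℕ} [hQ : Fact Q.Prime] (hm : 0 < m) (hmQ : Q % (4 * m) = 4 * m - 1)
    (hne : ((m : ℤ) : ZMod Q) ≠ 0) : IsSquare ((m : ℤ) : ZMod Q) := by
  rw [← legendreSym.eq_one_iff Q hne, jacobiSym.legendreSym.to_jacobiSym]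
  have hodd : Odd Q := by
    rw [Nat.odd_iff]
    have h1 := Nat.mod_mod_of_dvd Q (show 2 ∣ 4 * m by omega)
    rw [hmQ] at h1
    omega
  rw [jacobiSym.mod_right' m hodd, hmQ]
  have h4 : J(((4 * m : ℕ) : ℤ) | 4 * m - 1) = 1 := by
    rw [jacobiSym.mod_left' (a₂ := 1), jacobiSym.one_left]
    rw [Nat.cast_sub (by omega)]
    push_cast
    have e := Int.add_mul_emod_self_left 1 (4 * (m : ℤ) - 1) 1
    rwa [show (1 : ℤ) + (4 * m - 1) * 1 = 4 * m by ring] at e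
  push_cast at h4
  rw [jacobiSym.mul_left, show (4 : ℤ) = 2 ^ 2 by norm_num, jacobiSym.sq_one', one_mul] at h4
  · exact h4
  · rw [Int.gcd_comm]
    have : Nat.Coprime (4 * m - 1) 2 := by
      rw [Nat.coprime_two_right, Nat.odd_iff]; omega
    exact_mod_cast this

theorem isSquare_neg_p {p Q : ℕ} [hp : Fact p.Prime] [hQ : Fact Q.Prime] (h3 : p % 4 = 3)
    (hQ3 : Q % 4 = 3) (hpQ : p ≠ Q) (hQp : (Q : ZMod p) = 1) :
    IsSquare ((-p : ℤ) : ZMod Q) := by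
  have h1 : ¬ IsSquare (p : ZMod Q) := by
    rw [← ZMod.exists_sq_eq_prime_iff_of_mod_four_eq_three h3 hQ3 hpQ, hQp]
    exact ⟨1, by simp⟩
  have h2 : ¬ IsSquare (-1 : ZMod Q) := by
    rw [ZMod.exists_sq_eq_neg_one_iff]; omega
  have hpne : (p : ZMod Q) ≠ 0 := ZMod.prime_ne_zero Q p hpQ.symm
  have e1 := (quadraticChar_neg_one_iff_not_isSquare (F := ZMod Q)).2 h1
  have e2 := (quadraticChar_neg_one_iff_not_isSquare (F := ZMod Q)).2 h2
  have e3 : quadraticChar (ZMod Q) ((-p : ℤ) : ZMod Q) = 1 := by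
    rw [show ((-p : ℤ) : ZMod Q) = (-1) * p by push_cast; ring, map_mul, e1, e2]; rfl
  exact (quadraticChar_one_iff_isSquare (by simpa using hpne)).1 e3

theorem exists_Q {p m : ℕ} [hp : Fact p.Prime] (h3 : p % 4 = 3) (hm : 0 < m) (hpm : ¬ p ∣ m) :
    ∃ Q : ℕ, Q.Prime ∧ Q % (4 * m) = 4 * m - 1 ∧ (Q : ZMod p) = 1 := by
  have hcop : Nat.Coprime (4 * m) p := by
    rw [Nat.coprime_comm, hp.out.coprime_iff_not_dvd, hp.out.dvd_mul]
    rintro (h | h)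
    · have := Nat.le_of_dvd (by norm_num) h
      have : p = 3 := by have := hp.out.two_le; omega
      subst this
      omega
    · exact hpm h
  obtain ⟨k, hk1, hk2⟩ := Nat.chineseRemainder hcop (4 * m - 1) 1
  have hkc : Nat.Coprime k (4 * m * p) := by
    apply Nat.Coprime.mul_right
    · rw [Nat.Coprime, hk1.gcd_eq]
      have := Nat.coprime_sub_self_left (show 1 ≤ 4 * m by omega) 
      first
        | exact (Nat.coprime_self_sub_left (by omega)).2 (by simp)
        | exact (Nat.coprime_sub_self_left (by omega)).2 (by simp)
    · rw [Nat.Coprime, hk2.gcd_eq]; simp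
  obtain ⟨Q, -, hQ, hQk⟩ := Nat.forall_exists_prime_gt_and_modEq 0 (q := 4 * m * p) (a := k)
    (by have := hp.out.pos; positivity) hkc
  refine ⟨Q, hQ, ?_, ?_⟩
  · have : Q ≡ 4 * m - 1 [MOD 4 * m] := (hQk.of_mul_right _).trans hk1
    rw [Nat.ModEq] at this
    rw [this, Nat.mod_eq_of_lt (by omega)]
  · have : Q ≡ 1 [MOD p] := (hQk.of_mul_left _).trans hk2
    have := (ZMod.natCast_eq_natCast_iff _ _ _).2 this
    simpa using this

/-- Write a positive rational with odd `p`-adic valuation as `p * m * r²`. -/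
theorem exists_pm {p : ℕ} [hp : Fact p.Prime] {c : ℚ} (hc : 0 < c)
    (hv : Odd (c : ℚ_[p]).valuation) :
    ∃ (m : ℕ) (r : ℚ), 0 < m ∧ ¬ p ∣ m ∧ r ≠ 0 ∧ c = p * m * (r * r) := by
  have hd : (c.den : ℚ) ≠ 0 := by exact_mod_cast c.den_ne_zero
  have hn0 : c.num.natAbs * c.den ≠ 0 := by
    have := Rat.num_pos.2 hc
    have := c.den_pos
    apply Nat.mul_ne_zero <;> omega
  obtain ⟨k, m, hm, hkm⟩ := Nat.exists_eq_pow_mul_and_not_dvd hn0 p hp.out.ne_one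
  have hm0 : m ≠ 0 := by rintro rfl; simp at hm
  have hq : c * ((c.den : ℚ) * c.den) = (p : ℚ) ^ k * m := by
    rw [← num_den]
    have : (c.num * c.den : ℤ) = ((p ^ k * m : ℕ) : ℤ) := by
      rw [← hkm]
      push_cast
      rw [abs_of_pos (Rat.num_pos.2 hc)]
    rw [this]; push_cast; ring
  have hp0 : (p : ℚ) ≠ 0 := by exact_mod_cast hp.out.ne_zero
  have hk : Odd k := by
    have h1 := congrArg (fun x : ℚ => (x : ℚ_[p]).valuation) hq
    simp only [Rat.cast_mul, Rat.cast_pow, Rat.cast_natCast] at h1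
    have hd' : (c.den : ℚ_[p]) ≠ 0 := by exact_mod_cast c.den_ne_zero
    have hm' : (m : ℚ_[p]) ≠ 0 := by exact_mod_cast hm0
    rw [Padic.valuation_mul (ratCast_ne hc.ne') (mul_ne_zero hd' hd'), Padic.valuation_mul hd' hd',
      Padic.valuation_mul (pow_ne_zero _ p_ne) hm', Padic.valuation_pow, Padic.valuation_p,
      Padic.valuation_natCast m, padicValNat.eq_zero_of_not_dvd hm] at h1
    obtain ⟨t, ht⟩ := hv
    rw [ht] at h1
    rw [Nat.odd_iff]
    push_cast at h1
    omega
  obtain ⟨j, rfl⟩ := hk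
  refine ⟨m, (p : ℚ) ^ j / c.den, Nat.pos_of_ne_zero hm0, hm, by positivity, ?_⟩
  field_simp
  rw [← pow_two] at hq
  rw [hq]; ring

/-- The main global argument, with odd valuation of `a * b` at `p`. -/
theorem main_odd {p : ℕ} [hp : Fact p.Prime] (h3 : p % 4 = 3) {a b : ℚ} (ha : a < 0) (hb : b < 0)
    (hsp : sym (a : ℚ_[p]) (b : ℚ_[p]) = -1)
    (hsl : ∀ (l : ℕ) (_ : Fact l.Prime), l ≠ 2 → l ≠ p → sym (a : ℚ_[l]) (b : ℚ_[l]) = 1)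
    (hv : Odd ((a * b : ℚ) : ℚ_[p]).valuation) :
    Nonempty (ℍ[ℚ, a, b] ≃ₐ[ℚ] ℍ[ℚ, -1, -(p : ℚ)]) := by
  have hab : 0 < a * b := mul_pos_of_neg_of_neg ha hb
  obtain ⟨m, r, hm, hpm, hr, habm⟩ := exists_pm hab hv
  obtain ⟨Q, hQ, hQm, hQp⟩ := exists_Q h3 hm hpm
  have hQf : Fact Q.Prime := ⟨hQ⟩
  have hQ3 : Q % 4 = 3 := by
    have h1 := Nat.mod_mod_of_dvd Q (show 4 ∣ 4 * m from ⟨m, rfl⟩)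
    rw [hQm] at h1
    omega
  have hpQ : p ≠ Q := by
    rintro rfl
    simp at hQp
  have hpQ0 : (p : ZMod Q) ≠ 0 := ZMod.prime_ne_zero Q p hpQ.symm
  have hmQ0 : ((m : ℤ) : ZMod Q) ≠ 0 := by
    rw [Int.cast_natCast, Ne, ZMod.natCast_eq_zero_iff]
    intro hd
    obtain ⟨s, hs⟩ : Q ∣ 4 * m := hd.mul_left _
    have h1 := Nat.mod_mul_left_mod Q s Q
    rw [mul_comm s Q, ← hs, hQm, Nat.mod_self] at h1
    have h2 := Nat.dvd_of_mod_eq_zero h1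
    have h3 : Q ∣ 4 * m := hd.mul_left _
    have h4 : Q ∣ 1 := by
      have := Nat.dvd_sub h3 h2
      rwa [show 4 * m - (4 * m - 1) = 1 by omega] at this
    exact hQ.one_lt.ne' (Nat.dvd_one.1 h4)
  have sqm := isSquare_m hm hQm hmQ0
  have sqp := isSquare_neg_p h3 hQ3 hpQ hQp
  -- `-Q ≡ 1` modulo the primes dividing `m`
  have hQl : ∀ l : ℕ, l ∣ m → ((-Q : ℤ) : ZMod l) = 1 := by
    intro l hl
    have h1 : ((Q + 1 : ℕ) : ZMod l) = 0 := by
      rw [ZMod.natCast_eq_zero_iff]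
      have h2 : 4 * m ∣ Q + 1 := by
        rw [← Nat.div_add_mod Q (4 * m), hQm, add_assoc, Nat.sub_add_cancel (by omega)]
        exact (Dvd.intro _ rfl).add dvd_rfl
      exact (hl.mul_left 4).trans h2
    push_cast at h1 ⊢
    linear_combination -h1
  have hQne : ∀ (l : ℕ) (_ : Fact l.Prime), l ≠ Q → ((-Q : ℤ) : ZMod l) ≠ 0 := by
    intro l hl hlQ
    have : (Q : ZMod l) ≠ 0 := ZMod.prime_ne_zero l Q hlQ
    simpa using this
  have hQ0 : (0 : ℚ) < Q := by exact_mod_cast hQ.pos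
  have hp0 : (0 : ℚ) < p := by exact_mod_cast hp.out.pos
  have hm0 : (0 : ℚ) < m := by exact_mod_cast hm
  -- symbols of `-Q` against `m`
  have loc2 : Loc (-Q : ℚ) m := by
    intro l hl hl2
    have key : sym ((-Q : ℤ) : ℚ_[l]) ((m : ℤ) : ℚ_[l]) = 1 := by
      by_cases hlQ : l = Q
      · subst hlQ
        rw [sym_comm]
        exact sym_int_sq hmQ0 sqm _
      by_cases hlm : l ∣ m
      · exact sym_int_sq (hQne l hl hlQ) (by rw [hQl l hlm]; exact ⟨1, by simp⟩) _
      · refine sym_int_units (hQne l hl hlQ) ?_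
        rwa [Int.cast_natCast, Ne, ZMod.natCast_eq_zero_iff]
    push_cast at key ⊢
    exact key
  -- symbols of `Q` against `-p`
  have loc3 : Loc (Q : ℚ) (-p : ℚ) := by
    intro l hl hl2
    have key : sym ((Q : ℤ) : ℚ_[l]) ((-p : ℤ) : ℚ_[l]) = 1 := by
      by_cases hlQ : l = Q
      · subst hlQ
        rw [sym_comm]
        exact sym_int_sq (by simpa using hpQ0) sqp _
      have hne : ((Q : ℤ) : ZMod l) ≠ 0 := by simpa using hQne l hl hlQ
      by_cases hlp : l = p
      · subst hlp
        exact sym_int_sq hne (by rw [Int.cast_natCast, hQp]; exact ⟨1, by simp⟩) _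
      · refine sym_int_units hne ?_
        have : (p : ZMod l) ≠ 0 := ZMod.prime_ne_zero l p hlp
        simpa using this
    push_cast at key ⊢
    exact key
  have loc1 : Loc (a * (-Q)) (b * (-Q)) := by
    intro l hl hl2
    have ha' : (a : ℚ_[l]) ≠ 0 := ratCast_ne ha.ne
    have hb' : (b : ℚ_[l]) ≠ 0 := ratCast_ne hb.ne
    have hr' : (r : ℚ_[l]) ≠ 0 := ratCast_ne hr
    have hQ' : (-Q : ℚ_[l]) ≠ 0 := by
      have : (Q : ℚ_[l]) ≠ 0 := by exact_mod_cast hQ.ne_zero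
      simpa using this
    have hpm' : (-(p * m) : ℚ_[l]) ≠ 0 := by
      have h1 : (p : ℚ_[l]) ≠ 0 := by exact_mod_cast hp.out.ne_zero
      have h2 : (m : ℚ_[l]) ≠ 0 := by exact_mod_cast hm.ne'
      exact neg_ne_zero.2 (mul_ne_zero h1 h2)
    have hab' : -((a : ℚ_[l]) * b) = (-(p * m)) * (r * r) := by
      have := congrArg (fun x : ℚ => (x : ℚ_[l])) habm
      push_cast at this
      rw [this]; ring
    push_cast
    rw [sym_qq ha' hb' hQ', hab', sym_mul _ hpm' (mul_ne_zero hr' hr'), sym_sq _ hr', mul_one]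
    have hcast1 : (-Q : ℚ_[l]) = ((-Q : ℤ) : ℚ_[l]) := by push_cast; rfl
    have hcast2 : (-(p * m) : ℚ_[l]) = ((-(p * m) : ℤ) : ℚ_[l]) := by push_cast; rfl
    rw [hcast1, hcast2]
    by_cases hlp : l = p
    · subst hlp
      have hlQ : l ≠ Q := hpQ
      have hmne : ((-m : ℤ) : ZMod l) ≠ 0 := by
        have : (m : ZMod l) ≠ 0 := by rwa [Ne, ZMod.natCast_eq_zero_iff]
        simpa using this
      rw [hsp, sym_eo (by rw [val_int_unit (hQne l hl hlQ)]; exact Even.zero)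
        (by rw [show (-(l * m) : ℤ) = l * (-m) by ring, val_int_prime hmne]; exact odd_one)]
      have : chi ((-Q : ℤ) : ℚ_[l]) = -1 := by
        refine (Int.units_eq_one_or _).resolve_left ?_
        rw [chi_int_eq_one_iff _ (hQne l hl hlQ)]
        push_cast
        rw [hQp, ZMod.exists_sq_eq_neg_one_iff]
        omega
      rw [this]; rfl
    rw [hsl l hl hl2 hlp, one_mul]
    have hpl : (p : ZMod l) ≠ 0 := ZMod.prime_ne_zero l p hlp
    by_cases hlQ : l = Q
    · subst hlQ
      rw [sym_comm]
      refine sym_int_sq ?_ ?_ _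
      · have := mul_ne_zero hpl hmQ0
        simpa using this
      · have := sqp.mul sqm
        rwa [← Int.cast_mul, show (-p : ℤ) * m = -(p * m) by ring] at this
    by_cases hlm : l ∣ m
    · exact sym_int_sq (hQne l hl hlQ) (by rw [hQl l hlm]; exact ⟨1, by simp⟩) _
    · refine sym_int_units (hQne l hl hlQ) ?_
      have : (m : ZMod l) ≠ 0 := by rwa [Ne, ZMod.natCast_eq_zero_iff]
      simpa [hpl] using this
  -- apply Legendre's theorem three times
  have haQ : 0 < a * (-Q) := by nlinarith
  have hbQ : 0 < b * (-Q) := by nlinarith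
  obtain ⟨x1, y1, z1, n1, e1⟩ := legendre_rat _ _ haQ.ne' hbQ.ne' (Or.inl haQ) loc1
  obtain ⟨x2, y2, z2, n2, e2⟩ := legendre_rat _ _ (by linarith : (-Q : ℚ) < 0).ne hm0.ne'
    (Or.inr hm0) loc2
  obtain ⟨x3, y3, z3, n3, e3⟩ := legendre_rat _ _ hQ0.ne' (by linarith : (-p : ℚ) < 0).ne
    (Or.inl hQ0) loc3
  have hz1 : z1 ≠ 0 := by
    rintro rfl
    have f1 : 0 ≤ a * (-Q) * (x1 * x1) := mul_nonneg haQ.le (mul_self_nonneg _)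
    have f2 : 0 ≤ b * (-Q) * (y1 * y1) := mul_nonneg hbQ.le (mul_self_nonneg _)
    have g1 : a * (-Q) * (x1 * x1) = 0 := by linarith
    have g2 : b * (-Q) * (y1 * y1) = 0 := by linarith
    apply n1
    refine ⟨?_, ?_, rfl⟩
    · simpa using (mul_eq_zero.1 g1).resolve_left haQ.ne'
    · simpa using (mul_eq_zero.1 g2).resolve_left hbQ.ne'
  have hy2 : y2 ≠ 0 := by
    rintro rfl
    have f1 : 0 ≤ Q * (x2 * x2) := mul_nonneg hQ0.le (mul_self_nonneg _)
    have f2 : 0 ≤ z2 * z2 := mul_self_nonneg _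
    have g1 : Q * (x2 * x2) = 0 := by linarith
    have g2 : z2 * z2 = 0 := by linarith
    apply n2
    refine ⟨?_, rfl, ?_⟩
    · simpa using (mul_eq_zero.1 g1).resolve_left hQ0.ne'
    · simpa using g2
  have hx3 : x3 ≠ 0 := by
    rintro rfl
    have f1 : 0 ≤ p * (y3 * y3) := mul_nonneg hp0.le (mul_self_nonneg _)
    have f2 : 0 ≤ z3 * z3 := mul_self_nonneg _
    have g1 : p * (y3 * y3) = 0 := by linarith
    have g2 : z3 * z3 = 0 := by linarith
    apply n3
    refine ⟨rfl, ?_, ?_⟩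
    · simpa using (mul_eq_zero.1 g1).resolve_left hp0.ne'
    · simpa using g2
  obtain ⟨f1⟩ := iso_step1 (x := Q * x1 / z1) (y := Q * y1 / z1) ha hb hQ0 (by
    field_simp
    linear_combination e1)
  have hm' : (m : ℚ) = (z2 / y2) ^ 2 + Q * (x2 / y2) ^ 2 := by
    field_simp
    linear_combination -e2
  obtain ⟨f2⟩ := iso_step2 (c := -Q) (d := -(a * b)) (r := -p)
    (m := p * r * (z2 / y2)) (n := p * r * (x2 / y2))
    (by linarith) (by linarith) (by linarith) (by
    rw [habm]
    linear_combination (p * p * (r * r)) * hm')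
  obtain ⟨f3⟩ := iso_step3 (p := p) (Q := Q) (m := z3 / x3) (n := y3 / x3) hp0 hQ0 (by
    field_simp
    linear_combination -e3)
  exact ⟨((f3.trans f2).trans f1).symm⟩

theorem main_sym {p : ℕ} [hp : Fact p.Prime] (h3 : p % 4 = 3) {a b : ℚ} (ha : a < 0) (hb : b < 0)
    (hsp : sym (a : ℚ_[p]) (b : ℚ_[p]) = -1)
    (hsl : ∀ (l : ℕ) (_ : Fact l.Prime), l ≠ 2 → l ≠ p → sym (a : ℚ_[l]) (b : ℚ_[l]) = 1) :
    Nonempty (ℍ[ℚ, a, b] ≃ₐ[ℚ] ℍ[ℚ, -1, -(p : ℚ)]) := by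
  have ha' : (a : ℚ_[p]) ≠ 0 := ratCast_ne ha.ne
  have hb' : (b : ℚ_[p]) ≠ 0 := ratCast_ne hb.ne
  by_cases hv : Odd ((a * b : ℚ) : ℚ_[p]).valuation
  · exact main_odd h3 ha hb hsp hsl hv
  have hab : 0 < a * b := mul_pos_of_neg_of_neg ha hb
  have hbo : Odd (b : ℚ_[p]).valuation := by
    by_contra hbe
    rw [Int.not_odd_iff_even] at hbe hv
    rw [Rat.cast_mul, Padic.valuation_mul ha' hb', Int.even_add] at hv
    rw [sym_ee (hv.2 hbe) hbe] at hsp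
    exact absurd hsp (by decide)
  obtain ⟨f⟩ := iso_neg_mul ha hb
  have hc : ∀ (l : ℕ) (_ : Fact l.Prime), sym (a : ℚ_[l]) ((-(a * b) : ℚ) : ℚ_[l]) =
      sym (a : ℚ_[l]) (b : ℚ_[l]) := by
    intro l hl
    push_cast
    exact sym_neg_mul (ratCast_ne ha.ne) (ratCast_ne hb.ne)
  obtain ⟨g⟩ := main_odd h3 (a := a) (b := -(a * b)) ha (by linarith) ((hc p hp).trans hsp)
    (fun l hl h2 hlp => (hc l hl).trans (hsl l hl h2 hlp)) (by
      push_cast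
      rw [show (a : ℚ_[p]) * -(a * b) = -(a * a * b) by ring, val_neg,
        Padic.valuation_mul (mul_ne_zero ha' ha') hb', Padic.valuation_mul ha' ha']
      exact Even.add_odd ⟨_, rfl⟩ hbo)
  exact ⟨f.symm.trans g⟩

/-! ### From algebras to norm forms -/

theorem star_mul_norm {F : Type*} [Field F] {a b : F} (q : ℍ[F, a, b]) :
    q * star q = algebraMap F ℍ[F, a, b] (q.re * q.re - a * (q.imI * q.imI) - b * (q.imJ * q.imJ)
      + a * b * (q.imK * q.imK)) := by
  ext <;> simp [QuaternionAlgebra.algebraMap_eq] <;> ring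

theorem aniso_of_division {F : Type*} [Field F] {a b : F}
    (h : ∀ x : ℍ[F, a, b], x ≠ 0 → IsUnit x) (q : ℍ[F, a, b])
    (hq : q.re * q.re - a * (q.imI * q.imI) - b * (q.imJ * q.imJ)
      + a * b * (q.imK * q.imK) = 0) : q = 0 := by
  by_contra hne
  have h1 := star_mul_norm q
  rw [hq, map_zero, (h q hne).mul_right_eq_zero, star_eq_zero] at h1
  exact hne h1

theorem iso_of_split {l : ℕ} [Fact l.Prime] {a b : ℚ_[l]}
    (f : ℍ[ℚ_[l], a, b] ≃ₐ[ℚ_[l]] Matrix (Fin 2) (Fin 2) ℚ_[l]) : Iso a b := by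
  let E : Matrix (Fin 2) (Fin 2) ℚ_[l] := !![0, 1; 0, 0]
  have hE : E * E = 0 := by
    ext i j; fin_cases i <;> fin_cases j <;> simp [E]
  have hE0 : E ≠ 0 := by
    intro h
    have := congrFun (congrFun h 0) 1
    simp [E] at this
  let q := f.symm E
  have hq0 : q ≠ 0 := by
    intro h
    apply hE0
    have := congrArg f h
    simpa [q] using this
  have hqq : q * q = 0 := by
    rw [← map_mul, hE, map_zero]
  have h1 := star_mul_norm q
  have h2 : q * (q * star q) = 0 := by rw [← mul_assoc, hqq, zero_mul]
  rw [h1, ← Algebra.commutes, ← Algebra.smul_def, smul_eq_zero] at h2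
  refine ⟨q.re, q.imI, q.imJ, q.imK, ?_, h2.resolve_right hq0⟩
  rintro ⟨e1, e2, e3, e4⟩
  apply hq0
  ext <;> assumption

theorem neg_of_real {a b : ℝ} (ha : a ≠ 0) (hb : b ≠ 0)
    (h : ∀ x : ℍ[ℝ, a, b], x ≠ 0 → IsUnit x) : a < 0 ∧ b < 0 := by
  constructor
  · by_contra hn
    have hs := Real.mul_self_sqrt (not_lt.1 hn)
    have := aniso_of_division h ⟨√a, 1, 0, 0⟩ (by simp [hs])
    have := congrArg QuaternionAlgebra.imI this
    simp at this
  · by_contra hn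
    have hs := Real.mul_self_sqrt (not_lt.1 hn)
    have := aniso_of_division h ⟨√b, 0, 1, 0⟩ (by simp [hs])
    have := congrArg QuaternionAlgebra.imJ this
    simp at this

end QRam


/-- Let `p ≡ 3 (mod 4)` be a prime and let `a, b ∈ ℚ` be nonzero such that
`ℍ[ℝ, a, b]` and `ℍ[ℚₚ, a, b]` are division algebras and `ℍ[ℚ_ℓ, a, b]` splits for
every prime `ℓ ≠ p`. Then `ℍ[ℚ, a, b] ≅ ℍ[ℚ, −1, −p]` as `ℚ`-algebras. -/
theorem quaternionAlgebra_iso_of_ramification (p : ℕ) [Fact p.Prime] (h : p % 4 = 3)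
    (a b : ℚ) (ha : a ≠ 0) (hb : b ≠ 0)
    (hreal : ∀ x : ℍ[ℝ, (a : ℝ), (b : ℝ)], x ≠ 0 → IsUnit x)
    (hp : ∀ x : ℍ[ℚ_[p], (a : ℚ_[p]), (b : ℚ_[p])], x ≠ 0 → IsUnit x)
    (hsplit : ∀ (ℓ : ℕ) (_ : Fact ℓ.Prime), ℓ ≠ p →
      Nonempty (ℍ[ℚ_[ℓ], (a : ℚ_[ℓ]), (b : ℚ_[ℓ])] ≃ₐ[ℚ_[ℓ]]
        Matrix (Fin 2) (Fin 2) ℚ_[ℓ])) :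
    Nonempty (ℍ[ℚ, a, b] ≃ₐ[ℚ] ℍ[ℚ, -1, -(p : ℚ)]) := by
  have ha' : (a : ℚ_[p]) ≠ 0 := QRam.ratCast_ne ha
  have hb' : (b : ℚ_[p]) ≠ 0 := QRam.ratCast_ne hb
  obtain ⟨h1, h2⟩ := QRam.neg_of_real (by exact_mod_cast ha) (by exact_mod_cast hb) hreal
  refine QRam.main_sym h (by exact_mod_cast h1) (by exact_mod_cast h2) ?_ ?_
  · refine (Int.units_eq_one_or _).resolve_left fun hs => ?_
    obtain ⟨x, y, z, w, hne, hq⟩ := QRam.iso_of_sym h ha' hb' hs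
    have h0 := QRam.aniso_of_division hp ⟨x, y, z, w⟩ hq
    exact hne ⟨congrArg QuaternionAlgebra.re h0, congrArg QuaternionAlgebra.imI h0,
      congrArg QuaternionAlgebra.imJ h0, congrArg QuaternionAlgebra.imK h0⟩
  · intro l hl _ hlp
    obtain ⟨f⟩ := hsplit l hl hlp
    exact QRam.sym_eq_one_of_iso (QRam.ratCast_ne ha) (QRam.ratCast_ne hb) (QRam.iso_of_split f)
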